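/- (Eigenvalue multiplicities of the DFT, case p ≡ 1 mod 4) Write p = 4l + 1. The DFT operator F on ℂ(ZMod p) is diagonalizable with eigenvalues among {1, −1, i, −i}, and the dimensions of its eigenspaces are: dim ker(F − 1) = l + 1, dim ker(F + 1) = l, dim ker(F − i·Id) = l, dim ker(F + i·Id) = l. -/

import Mathlib

open scoped BigOperators

noncomputable section

namespace DFTWeil

open scoped Classical

/-- Multiplication of the Heisenberg group `H = (V × V) × Z`,
`(v,z)·(v',z') = (v+v', z+z'+2⁻¹ ω(v,v'))` with `ω((t,w),(t',w')) = t w' - w t'`. -/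
def hMul {p : ℕ} (a b : (ZMod p × ZMod p) × ZMod p) : (ZMod p × ZMod p) × ZMod p :=
  (a.1 + b.1, a.2 + b.2 + (2 : ZMod p)⁻¹ * (a.1.1 * b.1.2 - a.1.2 * b.1.1))

/-- The additive character `ψ(z) = exp(2πi z/p)`. -/
def psi (p : ℕ) (z : ZMod p) : ℂ :=
  Complex.exp (2 * Real.pi * Complex.I * (z.val : ℂ) / p)

/-- The standard realization of the Heisenberg representation:
`(π((t,w),z) f)(x) = ψ(z + 2⁻¹ t w + w x) f(x+t)`. -/
def heis (p : ℕ) (h : (ZMod p × ZMod p) × ZMod p) :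
    (ZMod p → ℂ) →ₗ[ℂ] (ZMod p → ℂ) where
  toFun f x := psi p (h.2 + (2 : ZMod p)⁻¹ * h.1.1 * h.1.2 + h.1.2 * x) * f (x + h.1.1)
  map_add' f g := by funext x; simp [mul_add]
  map_smul' c f := by funext x; simp [Pi.smul_apply, smul_eq_mul]; ring

/-- The discrete Fourier transform `F[f](y) = p^(-1/2) Σ_x ψ(yx) f(x)`. -/
def dft (p : ℕ) [Fact p.Prime] : Module.End ℂ (ZMod p → ℂ) where
  toFun f y := ((Real.sqrt p : ℂ))⁻¹ * ∑ x : ZMod p, psi p (y * x) * f x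
  map_add' f g := by funext y; simp [mul_add, Finset.sum_add_distrib]
  map_smul' c f := by
    funext y
    simp [Pi.smul_apply, smul_eq_mul, Finset.mul_sum]
    ring_nf
    congr 1
    ext x
    ring

section Projections

variable {K V : Type*} [Field K] [AddCommGroup V] [Module K V] [FiniteDimensional K V]

theorem det_one_add_smul_of_isProj {W : Submodule K V} {P : Module.End K V}
    (h : LinearMap.IsProj W P) (c : K) :
    LinearMap.det (1 + (c - 1) • P) = c ^ Module.finrank K W := by
  have key : (1 + (c - 1) • P : Module.End K V) =
      (W.prodEquivOfIsCompl (LinearMap.ker P) h.isCompl).conj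
        (LinearMap.prodMap (c • LinearMap.id) LinearMap.id) := by
    conv_lhs => rw [h.eq_conj_prod_map']
    set e := W.prodEquivOfIsCompl (LinearMap.ker P) h.isCompl
    have h1 : (1 : Module.End K V) = e.conj LinearMap.id := by
      rw [LinearEquiv.conj_id]; rfl
    have h2 : e.toLinearMap ∘ₗ LinearMap.prodMap LinearMap.id 0 ∘ₗ e.symm.toLinearMap =
        e.conj (LinearMap.prodMap LinearMap.id 0) := by
      rw [LinearEquiv.conj_apply, LinearMap.comp_assoc]
    rw [h1, h2, ← map_smul, ← map_add]
    congr 1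
    ext x <;> simp [sub_smul]
  rw [key, LinearEquiv.conj_apply, LinearMap.comp_assoc]
  have := LinearMap.det_conj (LinearMap.prodMap (c • LinearMap.id) LinearMap.id)
    (W.prodEquivOfIsCompl (LinearMap.ker P) h.isCompl)
  rw [this, LinearMap.det_prodMap]
  simp

end Projections

section FourthRoots

variable {V : Type*} [AddCommGroup V] [Module ℂ V]

/-- The spectral projection of an operator `F` with `F ^ 4 = 1` onto its `c`-eigenspace, for
`c ^ 4 = 1`. -/
def specProj (F : Module.End ℂ V) (c : ℂ) : Module.End ℂ V :=
  (4 : ℂ)⁻¹ • (1 + c ^ 3 • F + c ^ 2 • F ^ 2 + c • F ^ 3)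

variable {F : Module.End ℂ V} {c d : ℂ}

theorem specProj_apply_of_eigen {x : V} (hx : F x = c • x) :
    specProj F d x = ((4 : ℂ)⁻¹ * (1 + d ^ 3 * c + d ^ 2 * c ^ 2 + d * c ^ 3)) • x := by
  simp only [specProj, pow_succ F, pow_zero, one_mul, LinearMap.smul_apply, LinearMap.add_apply,
    Module.End.mul_apply, Module.End.one_apply, hx, map_smul]
  module

theorem apply_specProj (hF : F ^ 4 = 1) (hc : c ^ 4 = 1) (x : V) :
    F (specProj F c x) = c • specProj F c x := by
  have h4 : F (F (F (F x))) = x := by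
    have := LinearMap.congr_fun hF x
    simpa [pow_succ] using this
  simp only [specProj, pow_succ F, pow_zero, one_mul, LinearMap.smul_apply, LinearMap.add_apply,
    Module.End.mul_apply, Module.End.one_apply, map_smul, map_add, h4]
  have h5 : c • c ^ 3 • F x = F x := by
    rw [smul_smul, ← pow_succ', hc, one_smul]
  simp only [smul_comm c (4 : ℂ)⁻¹, smul_add, h5]
  module

theorem specProj_isProj (hF : F ^ 4 = 1) (hc : c ^ 4 = 1) :
    LinearMap.IsProj (LinearMap.ker (F - c • 1)) (specProj F c) where
  map_mem x := by simp [apply_specProj hF hc]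
  map_id x hx := by
    have hx' : F x = c • x := by simpa [sub_eq_zero] using hx
    rw [specProj_apply_of_eigen hx']
    have : (4 : ℂ)⁻¹ * (1 + c ^ 3 * c + c ^ 2 * c ^ 2 + c * c ^ 3) = 1 := by
      linear_combination (3 / 4) * hc
    rw [this, one_smul]

theorem specProj_mul_specProj (hF : F ^ 4 = 1) (hd : d ^ 4 = 1)
    (h : 1 + c ^ 3 * d + c ^ 2 * d ^ 2 + c * d ^ 3 = 0) : specProj F c * specProj F d = 0 := by
  ext x
  simp [specProj_apply_of_eigen (apply_specProj hF hd x), h]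

theorem sum_specProj :
    specProj F 1 + specProj F (-1) + specProj F Complex.I + specProj F (-Complex.I) = 1 := by
  ext x
  have h3 : Complex.I ^ 3 = -Complex.I := by simp [pow_succ]
  have h3' : (-Complex.I) ^ 3 = Complex.I := by simp [pow_succ]
  simp only [specProj, LinearMap.add_apply, LinearMap.smul_apply, h3, h3', neg_sq, Complex.I_sq]
  module

theorem sum_smul_specProj :
    specProj F 1 - specProj F (-1) + Complex.I • specProj F Complex.I -
      Complex.I • specProj F (-Complex.I) = F := by
  have h3 : Complex.I ^ 3 = -Complex.I := by simp [pow_succ]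
  have h3' : (-Complex.I) ^ 3 = Complex.I := by simp [pow_succ]
  simp only [specProj, h3, h3', neg_sq, Complex.I_sq]
  match_scalars <;> ring_nf <;> norm_num

theorem sum_sq_smul_specProj :
    specProj F 1 + specProj F (-1) - specProj F Complex.I - specProj F (-Complex.I) = F ^ 2 := by
  have h3 : Complex.I ^ 3 = -Complex.I := by simp [pow_succ]
  have h3' : (-Complex.I) ^ 3 = Complex.I := by simp [pow_succ]
  simp only [specProj, h3, h3', neg_sq, Complex.I_sq]
  module

theorem sup_ker_eq_top (hF : F ^ 4 = 1) :
    LinearMap.ker (F - 1) ⊔ LinearMap.ker (F + 1) ⊔ LinearMap.ker (F - Complex.I • 1) ⊔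
      LinearMap.ker (F + Complex.I • 1) = ⊤ := by
  refine eq_top_iff.2 fun x _ ↦ ?_
  have hx := LinearMap.congr_fun (sum_specProj (F := F)) x
  rw [Module.End.one_apply] at hx
  rw [← hx]
  refine Submodule.add_mem_sup (Submodule.add_mem_sup (Submodule.add_mem_sup ?_ ?_) ?_) ?_
  · simpa using (specProj_isProj (c := 1) hF (by norm_num)).map_mem x
  · simpa using (specProj_isProj (c := -1) hF (by norm_num)).map_mem x
  · exact (specProj_isProj (c := Complex.I) hF (by simp)).map_mem x
  · simpa using (specProj_isProj (c := -Complex.I) hF (by simp [pow_succ])).map_mem x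

variable [FiniteDimensional ℂ V]

theorem trace_specProj (hF : F ^ 4 = 1) (hc : c ^ 4 = 1) :
    LinearMap.trace ℂ V (specProj F c) = Module.finrank ℂ (LinearMap.ker (F - c • 1)) :=
  (specProj_isProj hF hc).trace

theorem det_eq_of_pow_four_eq_one (hF : F ^ 4 = 1) :
    LinearMap.det F = (-1) ^ Module.finrank ℂ (LinearMap.ker (F - (-1 : ℂ) • 1)) *
      Complex.I ^ Module.finrank ℂ (LinearMap.ker (F - Complex.I • 1)) *
      (-Complex.I) ^ Module.finrank ℂ (LinearMap.ker (F - (-Complex.I) • 1)) := by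
  have hI : Complex.I ^ 4 = 1 := by simp
  have hI' : (-Complex.I) ^ 4 = 1 := by simp [pow_succ]
  have hI3 : Complex.I ^ 3 = -Complex.I := by simp [pow_succ]
  rw [← det_one_add_smul_of_isProj (specProj_isProj (c := -1) hF (by norm_num)),
    ← det_one_add_smul_of_isProj (specProj_isProj hF hI),
    ← det_one_add_smul_of_isProj (specProj_isProj hF hI'), ← map_mul, ← map_mul]
  congr 1
  have h1 : specProj F (-1) * specProj F Complex.I = 0 :=
    specProj_mul_specProj hF hI (by rw [hI3]; norm_num)
  have h2 : specProj F (-1) * specProj F (-Complex.I) = 0 :=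
    specProj_mul_specProj hF hI' (by simp [pow_succ])
  have h3 : specProj F Complex.I * specProj F (-Complex.I) = 0 :=
    specProj_mul_specProj hF hI' (by simp [pow_succ])
  simp only [mul_add, add_mul, one_mul, mul_one, smul_mul_assoc, mul_smul_comm, h1, h2, h3,
    smul_zero, add_zero]
  conv_lhs => rw [← sum_smul_specProj (F := F)]
  rw [← sum_specProj (F := F)]
  module

end FourthRoots

theorem psi_eq_stdAddChar (p : ℕ) [NeZero p] (z : ZMod p) : psi p z = ZMod.stdAddChar z := by
  have h := ZMod.stdAddChar_coe (N := p) (z.val : ℤ)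
  rw [Int.cast_natCast, Int.cast_natCast, ZMod.natCast_zmod_val] at h
  rw [h, psi]

theorem sqrt_inv_mul_self (p : ℕ) :
    ((Real.sqrt p : ℂ))⁻¹ * ((Real.sqrt p : ℂ))⁻¹ = (p : ℂ)⁻¹ := by
  rw [← mul_inv, ← Complex.ofReal_mul, Real.mul_self_sqrt (Nat.cast_nonneg p)]
  simp

section Fourier

variable (p : ℕ) [Fact p.Prime]

theorem zmod_two_ne_zero (hp : p ≠ 2) : (2 : ZMod p) ≠ 0 := by
  intro h
  have h' : p ∣ 2 := (ZMod.natCast_eq_zero_iff 2 p).1 (by exact_mod_cast h)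
  exact hp ((Nat.prime_dvd_prime_iff_eq Fact.out Nat.prime_two).1 h')

/-- The matrix of the discrete Fourier transform. -/
def dftMatrix : Matrix (ZMod p) (ZMod p) ℂ :=
  Matrix.of fun y x ↦ ((Real.sqrt p : ℂ))⁻¹ * ZMod.stdAddChar (y * x)

theorem dft_eq_toLin' : dft p = Matrix.toLin' (dftMatrix p) := by
  refine LinearMap.ext fun f ↦ funext fun y ↦ ?_
  simp [dft, dftMatrix, Matrix.mulVec, dotProduct, psi_eq_stdAddChar, Finset.mul_sum, mul_assoc]

theorem sum_stdAddChar_mul (b : ZMod p) :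
    ∑ x : ZMod p, ZMod.stdAddChar (x * b) = if b = 0 then (p : ℂ) else 0 := by
  have := AddChar.sum_mulShift b (ZMod.isPrimitive_stdAddChar p)
  rw [this, ZMod.card]
  split_ifs <;> simp

theorem dftMatrix_mul_self :
    dftMatrix p * dftMatrix p = Matrix.of fun y x ↦ if y + x = 0 then 1 else 0 := by
  ext y x
  have hp : (p : ℂ) ≠ 0 := Nat.cast_ne_zero.2 (Fact.out : p.Prime).ne_zero
  have h (t : ZMod p) : dftMatrix p y t * dftMatrix p t x =
      (p : ℂ)⁻¹ * ZMod.stdAddChar (t * (y + x)) := by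
    rw [← sqrt_inv_mul_self, mul_add, AddChar.map_add_eq_mul, mul_comm t y]
    simp only [dftMatrix, Matrix.of_apply]
    ring
  simp only [Matrix.mul_apply, h, ← Finset.mul_sum, sum_stdAddChar_mul, Matrix.of_apply]
  split_ifs <;> simp [hp]

theorem dft_pow_four : dft p ^ 4 = 1 := by
  have h : dftMatrix p ^ 4 = 1 := by
    rw [show 4 = 2 * 2 from rfl, pow_mul, sq, sq, dftMatrix_mul_self]
    ext y x
    simp only [Matrix.mul_apply, Matrix.of_apply, Matrix.one_apply, add_eq_zero_iff_eq_neg,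
      mul_ite, mul_one, mul_zero]
    rw [Finset.sum_eq_single (-x)] <;> simp +contextual
  rw [dft_eq_toLin', ← Matrix.toLin'_pow, h, Matrix.toLin'_one]; rfl

theorem trace_dft_sq (hp : p ≠ 2) : LinearMap.trace ℂ _ (dft p ^ 2) = 1 := by
  rw [dft_eq_toLin', ← Matrix.toLin'_pow, Matrix.trace_toLin'_eq, sq, dftMatrix_mul_self,
    Matrix.trace]
  have h (x : ZMod p) : x + x = 0 ↔ x = 0 := by
    rw [← two_mul, mul_eq_zero, or_iff_right (zmod_two_ne_zero p hp)]
  simp [h]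

theorem sq_trace_dft (hp : p % 4 = 1) : LinearMap.trace ℂ _ (dft p) ^ 2 = 1 := by
  have hp0 : (p : ℂ) ≠ 0 := Nat.cast_ne_zero.2 (Fact.out : p.Prime).ne_zero
  obtain ⟨i, hi⟩ := (ZMod.exists_sq_eq_neg_one_iff (p := p)).2 (by omega)
  have h2 : (2 : ZMod p) ≠ 0 := zmod_two_ne_zero p (by omega)
  have hi0 : i ≠ 0 := by rintro rfl; simp at hi
  have hbij : Function.Bijective
      (fun z : ZMod p × ZMod p ↦ (z.1 + i * z.2, z.1 - i * z.2)) := by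
    refine (Finite.injective_iff_bijective).1 fun a b hab ↦ ?_
    simp only [Prod.mk.injEq] at hab
    obtain ⟨h, h'⟩ := hab
    refine Prod.ext (mul_left_cancel₀ h2 ?_) (mul_left_cancel₀ (mul_ne_zero h2 hi0) ?_)
    · linear_combination h + h'
    · linear_combination h - h'
  have hsum : (∑ x : ZMod p, ZMod.stdAddChar (x * x)) ^ 2 = (p : ℂ) := by
    rw [sq, Finset.sum_mul_sum, ← Finset.sum_product', Finset.univ_product_univ]
    have h := hbij.sum_comp (fun z : ZMod p × ZMod p ↦ (ZMod.stdAddChar (z.1 * z.2) : ℂ))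
    have h' (z : ZMod p × ZMod p) : (z.1 + i * z.2) * (z.1 - i * z.2) =
        z.1 * z.1 + z.2 * z.2 := by linear_combination z.2 ^ 2 * hi
    simp only [h', AddChar.map_add_eq_mul] at h
    rw [h, Fintype.sum_prod_type_right]
    simp [sum_stdAddChar_mul]
  rw [dft_eq_toLin', Matrix.trace_toLin'_eq, Matrix.trace]
  simp only [Matrix.diag_apply, dftMatrix, Matrix.of_apply, ← Finset.mul_sum, mul_pow, hsum]
  rw [sq, sqrt_inv_mul_self, inv_mul_cancel₀ hp0]

end Fourier

theorem two_mul_sum_sum_Ioi_one (n : ℕ) :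
    2 * ∑ i : Fin n, ∑ _j ∈ Finset.Ioi i, 1 = n * (n - 1) := by
  have h := Finset.sum_sum_Ioi_add_eq_sum_sum_off_diag (fun _ _ : Fin n ↦ 1)
  simp only [Finset.sum_const, smul_eq_mul, mul_one, Finset.card_compl, Fintype.card_fin,
    Finset.card_singleton, Finset.card_univ] at h
  rw [← h, Finset.mul_sum]
  simp [mul_comm]

theorem two_mul_sum_sum_Ioi_add (n : ℕ) :
    2 * ∑ i : Fin n, ∑ j ∈ Finset.Ioi i, ((i : ℕ) + j) = (n - 1) * (n * (n - 1)) := by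
  have h := Finset.sum_sum_Ioi_add_eq_sum_sum_off_diag (fun _ i : Fin n ↦ (i : ℕ))
  have h' : ∑ i : Fin n, ∑ _j ∈ ({i}ᶜ : Finset (Fin n)), (i : ℕ) =
      (n - 1) * ∑ i : Fin n, (i : ℕ) := by
    simp [Finset.card_compl, Finset.mul_sum]
  rw [h, h', Fin.sum_univ_eq_sum_range (fun i ↦ i) n, mul_left_comm, mul_comm 2,
    Finset.sum_range_id_mul_two]

theorem exp_sub_exp (a b : ℝ) : Complex.exp (2 * b * Complex.I) - Complex.exp (2 * a * Complex.I) =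
    Complex.exp ((a + b) * Complex.I) * Complex.I * (2 * Real.sin (b - a) : ℝ) := by
  push_cast
  rw [Complex.sin]
  have h1 : Complex.exp (2 * b * Complex.I) =
      Complex.exp ((a + b) * Complex.I) * Complex.exp ((b - a) * Complex.I) := by
    rw [← Complex.exp_add]; ring_nf
  have h2 : Complex.exp (2 * a * Complex.I) =
      Complex.exp ((a + b) * Complex.I) * Complex.exp (-(b - a) * Complex.I) := by
    rw [← Complex.exp_add]; ring_nf
  rw [h1, h2]
  linear_combination (Complex.exp ((a + b) * Complex.I)) * (Complex.exp ((b - a) * Complex.I) -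
    Complex.exp (-(b - a) * Complex.I)) * Complex.I_sq

/-- Schur's evaluation of the sign of the determinant of the discrete Fourier transform. -/
theorem exists_det_dft_eq (p l : ℕ) [Fact p.Prime] (hp : p = 4 * l + 1) :
    ∃ r : ℝ, 0 < r ∧ LinearMap.det (dft p) = (-1) ^ l * r := by
  have hpos : 0 < p := by omega
  have hpC : (p : ℂ) ≠ 0 := Nat.cast_ne_zero.2 hpos.ne'
  have hpR : (0 : ℝ) < p := Nat.cast_pos.2 hpos
  have hbij : Function.Bijective (fun i : Fin p ↦ ((i : ℕ) : ZMod p)) := by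
    refine (Fintype.bijective_iff_injective_and_card _).2 ⟨fun a b hab ↦ ?_, by simp [ZMod.card]⟩
    have := (ZMod.natCast_eq_natCast_iff' _ _ _).1 hab
    rw [Nat.mod_eq_of_lt a.2, Nat.mod_eq_of_lt b.2] at this
    exact Fin.ext this
  let e : Fin p ≃ ZMod p := Equiv.ofBijective _ hbij
  have hv : (dftMatrix p).submatrix e e = ((Real.sqrt p : ℂ))⁻¹ • Matrix.vandermonde
      (fun i : Fin p ↦ Complex.exp (2 * (Real.pi * i / p : ℝ) * Complex.I)) := by
    ext i j
    simp only [Matrix.submatrix_apply, dftMatrix, Matrix.of_apply, Matrix.smul_apply,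
      Matrix.vandermonde_apply, smul_eq_mul, e, Equiv.ofBijective_apply]
    congr 1
    have h := ZMod.stdAddChar_coe (N := p) ((i * j : ℕ) : ℤ)
    push_cast at h
    rw [h, ← Complex.exp_nat_mul]
    congr 1
    push_cast
    ring
  rw [dft_eq_toLin', LinearMap.det_toLin', ← Matrix.det_submatrix_equiv_self e, hv,
    Matrix.det_smul, Matrix.det_vandermonde]
  simp only [exp_sub_exp, Finset.prod_mul_distrib]
  refine ⟨(Real.sqrt p)⁻¹ ^ Fintype.card (Fin p) * ∏ i : Fin p, ∏ j ∈ Finset.Ioi i,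
    (2 * Real.sin (Real.pi * j / p - Real.pi * i / p)), ?_, ?_⟩
  · refine mul_pos (pow_pos (inv_pos.2 (Real.sqrt_pos.2 hpR)) _)
      (Finset.prod_pos fun i _ ↦ Finset.prod_pos fun j hj ↦ ?_)
    have hij : ((i : ℕ) : ℝ) < (j : ℕ) := by exact_mod_cast Finset.mem_Ioi.1 hj
    have hjp : ((j : ℕ) : ℝ) < p := by exact_mod_cast j.2
    have hi0 : (0 : ℝ) ≤ (i : ℕ) := Nat.cast_nonneg _
    refine mul_pos two_pos (Real.sin_pos_of_pos_of_lt_pi ?_ ?_)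
    · rw [← sub_div, ← mul_sub]
      exact div_pos (mul_pos Real.pi_pos (sub_pos.2 hij)) hpR
    · rw [← sub_div, ← mul_sub, div_lt_iff₀ hpR]
      exact mul_lt_mul_of_pos_left (by linarith) Real.pi_pos
  · have hI : ∏ i : Fin p, ∏ _j ∈ Finset.Ioi i, Complex.I = (-1) ^ l := by
      have hs : ∑ i : Fin p, ∑ _j ∈ Finset.Ioi i, 1 = 2 * l + 4 * (2 * l * l) := by
        have h := two_mul_sum_sum_Ioi_one p
        rw [show p - 1 = 4 * l by omega] at h
        have : p * (4 * l) = 2 * (2 * l + 4 * (2 * l * l)) := by rw [hp]; ring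
        omega
      calc ∏ i : Fin p, ∏ _j ∈ Finset.Ioi i, Complex.I
          = Complex.I ^ ∑ i : Fin p, ∑ _j ∈ Finset.Ioi i, 1 := by
            simp [Finset.prod_pow_eq_pow_sum]
        _ = (-1) ^ l := by rw [hs, pow_add, pow_mul, pow_mul, Complex.I_sq, Complex.I_pow_four]; simp
    have hE : ∏ i : Fin p, ∏ j ∈ Finset.Ioi i, Complex.exp (((Real.pi * i / p : ℝ) +
        (Real.pi * j / p : ℝ)) * Complex.I) = 1 := by
      have hs : ∑ i : Fin p, ∑ j ∈ Finset.Ioi i, ((i : ℕ) + j) = p * (2 * (4 * l * l)) := by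
        have h := two_mul_sum_sum_Ioi_add p
        rw [show p - 1 = 4 * l by omega] at h
        have : 4 * l * (p * (4 * l)) = 2 * (p * (2 * (4 * l * l))) := by ring
        omega
      simp only [← Complex.exp_sum]
      rw [Complex.exp_eq_one_iff]
      refine ⟨(4 * l * l : ℕ), ?_⟩
      have hs' := congrArg (Nat.cast : ℕ → ℂ) hs
      push_cast at hs' ⊢
      have ht (i j : Fin p) : ((Real.pi : ℂ) * (i : ℕ) / p + Real.pi * (j : ℕ) / p) * Complex.I =
        (Real.pi / p * Complex.I) * ((i : ℕ) + (j : ℕ)) := by ring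
      simp only [ht, ← Finset.mul_sum]
      rw [hs']
      field_simp
    rw [hI, hE]
    push_cast
    ring

/-- Eigenvalue multiplicities of the DFT for `p = 4l + 1`. -/
theorem stmt16 (p l : ℕ) [Fact p.Prime] (hp : p = 4 * l + 1) :
    (LinearMap.ker (dft p - 1) ⊔ LinearMap.ker (dft p + 1) ⊔
      LinearMap.ker (dft p - Complex.I • 1) ⊔ LinearMap.ker (dft p + Complex.I • 1) = ⊤) ∧
    Module.finrank ℂ (LinearMap.ker (dft p - 1)) = l + 1 ∧
    Module.finrank ℂ (LinearMap.ker (dft p + 1)) = l ∧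
    Module.finrank ℂ (LinearMap.ker (dft p - Complex.I • 1)) = l ∧
    Module.finrank ℂ (LinearMap.ker (dft p + Complex.I • 1)) = l := by
  have hF := dft_pow_four p
  have hI : Complex.I ^ 4 = 1 := by simp
  have hI' : (-Complex.I) ^ 4 = 1 := by simp [pow_succ]
  have hN : (-1 : ℂ) ^ 4 = 1 := by norm_num
  refine ⟨sup_ker_eq_top hF, ?_⟩
  have t1 := trace_specProj hF (one_pow 4)
  have t2 := trace_specProj hF hN
  have t3 := trace_specProj hF hI
  have t4 := trace_specProj hF hI'
  have hdet := det_eq_of_pow_four_eq_one hF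
  rw [one_smul] at t1
  have k2 : dft p - (-1 : ℂ) • 1 = dft p + 1 := by ext; simp
  have k4 : dft p - (-Complex.I) • 1 = dft p + Complex.I • 1 := by ext; simp
  rw [k2] at t2 hdet
  rw [k4] at t4 hdet
  generalize Module.finrank ℂ (LinearMap.ker (dft p - 1)) = a at *
  generalize Module.finrank ℂ (LinearMap.ker (dft p + 1)) = b at *
  generalize Module.finrank ℂ (LinearMap.ker (dft p - Complex.I • 1)) = m at *
  generalize Module.finrank ℂ (LinearMap.ker (dft p + Complex.I • 1)) = n at *
  have e0 := congrArg (LinearMap.trace ℂ _) (sum_specProj (F := dft p))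
  have e1 := congrArg (LinearMap.trace ℂ _) (sum_smul_specProj (F := dft p))
  have e2 := congrArg (LinearMap.trace ℂ _) (sum_sq_smul_specProj (F := dft p))
  rw [trace_dft_sq p (by omega)] at e2
  have hsq := sq_trace_dft p (by omega)
  rw [← e1] at hsq
  simp only [map_add, map_sub, map_smul, t1, t2, t3, t4, LinearMap.trace_one, smul_eq_mul,
    Module.finrank_fintype_fun_eq_card, ZMod.card] at e0 e2 hsq
  have f0 : a + b + m + n = p := by exact_mod_cast e0
  have f2 : (a : ℤ) + b - m - n = 1 := by exact_mod_cast e2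
  have hre := congrArg Complex.re hsq
  have him := congrArg Complex.im hsq
  simp [sq] at hre him
  have g1 : ((a : ℤ) - b) ^ 2 - ((m : ℤ) - n) ^ 2 = 1 := by
    have : ((a : ℝ) - b) ^ 2 - ((m : ℝ) - n) ^ 2 = 1 := by linarith
    exact_mod_cast this
  have g2 : ((a : ℤ) - b) * ((m : ℤ) - n) = 0 := by
    have : ((a : ℝ) - b) * ((m : ℝ) - n) = 0 := by linarith
    exact_mod_cast this
  have hmn : m = n := by
    rcases mul_eq_zero.1 g2 with h | h
    · omega
    · omega
  subst hmn
  obtain ⟨r, hr, hdet'⟩ := exists_det_dft_eq p l hp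
  rw [hdet, mul_assoc, ← mul_pow, mul_neg, Complex.I_mul_I, neg_neg, one_pow, mul_one] at hdet'
  have hab : ((a : ℤ) - b - 1) * ((a : ℤ) - b + 1) = 0 := by linear_combination g1
  rcases mul_eq_zero.1 hab with h | h
  · omega
  · have hb : b = l + 1 := by omega
    have hs : ((-1 : ℝ)) ^ (l + 1) = (-1) ^ l * r := by
      rw [hb] at hdet'
      exact_mod_cast hdet'
    have : r = -1 := by
      refine mul_left_cancel₀ (pow_ne_zero l (by norm_num : (-1 : ℝ) ≠ 0)) ?_
      rw [← hs, pow_succ]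
    linarith

end DFTWeil
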